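/- Let (P_t)_{t≥0} be a Feller, stochastically continuous Markov transition semigroup on a Polish metric space 𝒳 with the e-property which is weak-* mean ergodic with invariant limit measure μ*. For a bounded Lipschitz function ψ set Ψ_t(x) := (1/t)∫₀^t P_s ψ(x) ds for t > 0, Ψ_0 := ψ, and d* := ∫ ψ dμ*. Then for every Borel probability measure μ on 𝒳: (a) lim_{T→∞} (1/T)∫₀^T (∫ P_t ψ dμ) dt = d*, and (b) lim_{T→∞} (2/T²) ∫₀^T (T−s) (∫ P_s(ψ·Ψ_{T−s}) dμ) ds = d*². (Statements (a) and (b) express the weak law of large numbers (090601) for the associated Markov process in purely semigroup terms.) -/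

import Mathlib

open MeasureTheory Filter Topology Metric Set

noncomputable section

/-- A Markov transition semigroup on a measurable space `X`: a jointly measurable family
of Markov probability kernels `P t x` with `P 0 x = δ_x` and the Chapman–Kolmogorov
semigroup property for nonnegative times. -/
structure MarkovSemigroup (X : Type*) [MeasurableSpace X] where
  P : ℝ → X → MeasureTheory.Measure X
  prob : ∀ t x, MeasureTheory.IsProbabilityMeasure (P t x)
  meas : Measurable fun p : ℝ × X => P p.1 p.2
  init : ∀ x : X, P 0 x = MeasureTheory.Measure.dirac x
  semigroup : ∀ t s : ℝ, 0 ≤ t → 0 ≤ s → ∀ x : X,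
    P (t + s) x = (P t x).bind (P s)

namespace MarkovSemigroup

variable {X : Type*} [MeasurableSpace X]

/-- Action `P_t f(x) = ∫ f(y) P_t(x,dy)` on functions. -/
def act (M : MarkovSemigroup X) (t : ℝ) (f : X → ℝ) (x : X) : ℝ :=
  ∫ y, f y ∂(M.P t x)

/-- Dual action `P_t^* μ` on measures. -/
def dual (M : MarkovSemigroup X) (t : ℝ) (μ : MeasureTheory.Measure X) :
    MeasureTheory.Measure X :=
  μ.bind (M.P t)

/-- The time average `Q^T μ = (1/T) ∫_0^T P_s^* μ ds` (with the convention
`Q^T μ = μ` for `T ≤ 0`). -/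
def QM (M : MarkovSemigroup X) (T : ℝ) (μ : MeasureTheory.Measure X) :
    MeasureTheory.Measure X :=
  if T ≤ 0 then μ
  else ((ENNReal.ofReal (1 / T)) • (volume.restrict (Set.Ioc (0 : ℝ) T))).bind
    fun s => M.dual s μ

/-- `Q^T(x,·) := Q^T δ_x`. -/
def Q (M : MarkovSemigroup X) (T : ℝ) (x : X) : MeasureTheory.Measure X :=
  M.QM T (MeasureTheory.Measure.dirac x)

/-- Iterated averages: for `ts = [t_k, …, t_1]`, `QMs ts μ = Q^{t_k}(⋯(Q^{t_1} μ)⋯)`. -/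
def QMs (M : MarkovSemigroup X) (ts : List ℝ) (μ : MeasureTheory.Measure X) :
    MeasureTheory.Measure X :=
  ts.foldr (fun t ν => M.QM t ν) μ

/-- A measure is invariant if `P_t^* μ = μ` for all `t ≥ 0`. -/
def Invariant (M : MarkovSemigroup X) (μ : MeasureTheory.Measure X) : Prop :=
  ∀ t : ℝ, 0 ≤ t → M.dual t μ = μ

section TopologicalDefs

variable [TopologicalSpace X]

/-- Bounded continuous real functions. -/
def IsBddContinuous (f : X → ℝ) : Prop :=
  Continuous f ∧ ∃ C : ℝ, ∀ x, |f x| ≤ C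

/-- The Feller property: `P_t` maps bounded continuous functions to continuous ones. -/
def Feller (M : MarkovSemigroup X) : Prop :=
  ∀ t : ℝ, 0 ≤ t → ∀ f : X → ℝ, MarkovSemigroup.IsBddContinuous f →
    Continuous (M.act t f)

/-- Stochastic continuity: `P_t f(x) → f(x)` as `t → 0+`. -/
def StochasticallyContinuous (M : MarkovSemigroup X) : Prop :=
  ∀ f : X → ℝ, MarkovSemigroup.IsBddContinuous f → ∀ x : X,
    Filter.Tendsto (fun t : ℝ => M.act t f x) (nhdsWithin 0 (Set.Ioi 0)) (nhds (f x))

/-- Weak convergence of `Q^T ν` to `μ` as `T → ∞`. -/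
def QTendsto (M : MarkovSemigroup X) (ν μ : MeasureTheory.Measure X) : Prop :=
  ∀ f : X → ℝ, MarkovSemigroup.IsBddContinuous f →
    Filter.Tendsto (fun T : ℝ => ∫ x, f x ∂(M.QM T ν)) Filter.atTop
      (nhds (∫ x, f x ∂μ))

/-- Weak-* mean ergodicity with limit `μstar`. -/
def WeakStarMeanErgodic (M : MarkovSemigroup X) (μstar : MeasureTheory.Measure X) : Prop :=
  ∀ ν : MeasureTheory.Measure X, MeasureTheory.IsProbabilityMeasure ν → M.QTendsto ν μstar

/-- Tightness of the family `(Q^T(x,·))_{T>0}`. -/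
def TightAt (M : MarkovSemigroup X) (x : X) : Prop :=
  ∀ ε : ℝ, 0 < ε → ∃ K : Set X, IsCompact K ∧
    ∀ T : ℝ, 0 < T → 1 - ε ≤ ((M.Q T x) K).toReal

end TopologicalDefs

end MarkovSemigroup

/-- Topological support of a measure: points all of whose open neighborhoods
have positive mass. -/
def msupport {X : Type*} [MeasurableSpace X] [TopologicalSpace X]
    (μ : MeasureTheory.Measure X) : Set X :=
  {x : X | ∀ U : Set X, IsOpen U → x ∈ U → 0 < μ U}

/-- Total variation distance between two (finite) measures, as the supremum over
Borel sets of the discrepancy of masses. -/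
def tvDist {X : Type*} [MeasurableSpace X] (μ ν : MeasureTheory.Measure X) : ℝ :=
  ⨆ B : {B : Set X // MeasurableSet B}, |(μ B.1).toReal - (ν B.1).toReal|

section MetricDefs

variable {X : Type*} [MeasurableSpace X] [PseudoMetricSpace X]

/-- Bounded Lipschitz real functions. -/
def IsBddLipschitz (ψ : X → ℝ) : Prop :=
  (∃ K : NNReal, LipschitzWith K ψ) ∧ ∃ C : ℝ, ∀ x, |ψ x| ≤ C

/-- The e-property: equicontinuity of `(P_t ψ)_{t ≥ 0}` at every point, for every
bounded Lipschitz `ψ`. -/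
def MarkovSemigroup.EProperty (M : MarkovSemigroup X) : Prop :=
  ∀ ψ : X → ℝ, IsBddLipschitz ψ → ∀ x : X, ∀ ε : ℝ, 0 < ε →
    ∃ δ : ℝ, 0 < δ ∧ ∀ z : X, dist z x < δ → ∀ t : ℝ, 0 ≤ t →
      |M.act t ψ z - M.act t ψ x| < ε

end MetricDefs

/-- `Ψ_t(x) = (1/t) ∫_0^t P_s ψ(x) ds` for `t > 0`, and `Ψ_0 = ψ`. -/
def MarkovSemigroup.Psi {X : Type*} [MeasurableSpace X] (M : MarkovSemigroup X)
    (ψ : X → ℝ) (t : ℝ) (x : X) : ℝ :=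
  if t ≤ 0 then ψ x else (1 / t) * ∫ s in Set.Ioc (0 : ℝ) t, M.act s ψ x

theorem integral_bind_of_bounded {α β : Type*} [MeasurableSpace α] [MeasurableSpace β]
    (μ : Measure α) [IsFiniteMeasure μ] {κ : α → Measure β} (hκ : Measurable κ)
    (hκp : ∀ a, IsProbabilityMeasure (κ a)) {f : β → ℝ} (hf : Measurable f) {C : ℝ}
    (hC : ∀ y, |f y| ≤ C) :
    ∫ y, f y ∂(μ.bind κ) = ∫ a, ∫ y, f y ∂(κ a) ∂μ := by
  let k : ProbabilityTheory.Kernel α β := ⟨κ, hκ⟩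
  have : ProbabilityTheory.IsMarkovKernel k := ⟨hκp⟩
  exact ProbabilityTheory.Kernel.integral_comp (η := k)
    (κ := ProbabilityTheory.Kernel.const Unit μ) (a := ())
    (.of_bound hf.aestronglyMeasurable C (.of_forall hC))

theorem abs_integral_le_of_abs_le {α : Type*} [MeasurableSpace α]
    (μ : Measure α) [IsProbabilityMeasure μ] {f : α → ℝ} {C : ℝ} (hC : ∀ y, |f y| ≤ C) :
    |∫ y, f y ∂μ| ≤ C := by
  simpa using norm_integral_le_of_norm_le_const (μ := μ) (f := f) (.of_forall hC)

theorem abs_setIntegral_Ioc_le {f : ℝ → ℝ} {C T : ℝ} (hT : 0 ≤ T)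
    (hC : ∀ s ∈ Ioc 0 T, |f s| ≤ C) : |∫ s in Ioc 0 T, f s| ≤ C * T := by
  simpa [hT] using norm_setIntegral_le_of_norm_le_const (μ := volume) (s := Ioc 0 T)
    (f := f) measure_Ioc_lt_top hC

theorem integrableOn_Ioc_of_bounded {f : ℝ → ℝ} (hf : Measurable f) {C : ℝ} (a b : ℝ)
    (hC : ∀ s ∈ Ioc a b, |f s| ≤ C) : IntegrableOn f (Ioc a b) :=
  IntegrableOn.of_bound measure_Ioc_lt_top hf.aestronglyMeasurable C
    ((ae_restrict_iff' measurableSet_Ioc).2 (.of_forall hC))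

theorem setIntegral_sub_mul_eq {g : ℝ → ℝ} (hg : Measurable g) {C : ℝ} (hC : ∀ s, |g s| ≤ C)
    (T : ℝ) :
    ∫ s in Ioc 0 T, (T - s) * g s = ∫ u in Ioc 0 T, ∫ s in Ioc 0 u, g s := by
  let F : ℝ → ℝ → ℝ := fun s u => (Ioc 0 u).indicator g s
  have hF : Measurable (Function.uncurry F) := by
    have : Function.uncurry F = {p : ℝ × ℝ | 0 < p.1 ∧ p.1 ≤ p.2}.indicator (fun p => g p.1) := by
      ext p; rfl
    rw [this]
    refine (hg.comp measurable_fst).indicator ?_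
    exact (measurableSet_lt measurable_const measurable_fst).inter
      (measurableSet_le measurable_fst measurable_snd)
  have hswap := integral_integral_swap (μ := volume.restrict (Ioc 0 T))
    (ν := volume.restrict (Ioc 0 T)) (f := F)
    (.of_bound hF.aestronglyMeasurable C (.of_forall fun p => by
      refine (norm_indicator_le_norm_self _ _).trans (hC _)))
  calc ∫ s in Ioc 0 T, (T - s) * g s
      = ∫ s in Ioc 0 T, ∫ u in Ioc 0 T, F s u := by
        refine setIntegral_congr_fun measurableSet_Ioc fun s hs => ?_
        have : ∀ u, F s u = (Ici s).indicator (fun _ => g s) u := fun u => by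
          simp only [F, indicator, mem_Ioc, mem_Ici, hs.1, true_and]
        simp only [this]
        rw [integral_indicator measurableSet_Ici, Measure.restrict_restrict measurableSet_Ici,
          setIntegral_const]
        have : Ici s ∩ Ioc 0 T = Icc s T := by
          ext u; simp only [mem_inter_iff, mem_Ici, mem_Ioc, mem_Icc]
          exact ⟨fun h => ⟨h.1, h.2.2⟩, fun h => ⟨h.1, hs.1.trans_le h.1, h.2⟩⟩
        rw [this]
        simp [hs.2]
    _ = ∫ u in Ioc 0 T, ∫ s in Ioc 0 T, F s u := hswap
    _ = _ := by
        refine setIntegral_congr_fun measurableSet_Ioc fun u hu => ?_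
        simp only [F]
        rw [integral_indicator measurableSet_Ioc, Measure.restrict_restrict measurableSet_Ioc,
          inter_eq_left.2 (Ioc_subset_Ioc_right hu.2)]

theorem tendsto_weighted_average {g : ℝ → ℝ} (hg : Measurable g) {C : ℝ} (hC : ∀ s, |g s| ≤ C)
    {d : ℝ} (h : Tendsto (fun T : ℝ => (1 / T) * ∫ s in Ioc 0 T, g s) atTop (𝓝 d)) :
    Tendsto (fun T : ℝ => (2 / T ^ 2) * ∫ s in Ioc 0 T, (T - s) * g s) atTop (𝓝 d) := by
  have hC0 : 0 ≤ C := (abs_nonneg _).trans (hC 0)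
  set G : ℝ → ℝ := fun u => ∫ s in Ioc 0 u, g s with hG
  have hGC : ∀ u, 0 ≤ u → |G u| ≤ C * u := fun u hu => abs_setIntegral_Ioc_le hu fun s _ => hC s
  have hGi : ∀ T, IntegrableOn G (Ioc 0 T) := fun T => by
    have : ContinuousOn (fun u => ∫ s in (0:ℝ)..u, g s) (uIcc 0 T) := by
      refine (intervalIntegral.continuous_primitive (fun a b => ?_) 0).continuousOn
      rw [intervalIntegrable_iff]
      exact integrableOn_Ioc_of_bounded hg _ _ fun s _ => hC s
    rcases le_or_gt 0 T with hT | hT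
    · rw [uIcc_of_le hT] at this
      refine (this.integrableOn_Icc.mono_set Ioc_subset_Icc_self).congr_fun (fun u hu => ?_)
        measurableSet_Ioc
      exact intervalIntegral.integral_of_le hu.1.le
    · simp [Ioc_eq_empty_of_le hT.le]
  rw [Metric.tendsto_atTop] at h ⊢
  intro ε hε
  obtain ⟨U, hU⟩ := h (ε / 4) (by positivity)
  set V := max U 1 with hV
  have hV1 : 1 ≤ V := le_max_right _ _
  set A := (C + |d|) * V with hA
  have hA0 : 0 ≤ A := by positivity
  have key : ∀ u, 0 < u → |G u - d * u| ≤ ε / 4 * u + A := by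
    intro u hu
    rcases le_or_gt V u with h1 | h1
    · have h2 := hU u ((le_max_left _ _).trans h1)
      rw [Real.dist_eq] at h2
      have : G u - d * u = (1 / u * G u - d) * u := by field_simp
      rw [this, abs_mul, abs_of_pos hu]
      nlinarith
    · have h2 := hGC u hu.le
      have h3 : |G u - d * u| ≤ |G u| + |d * u| := abs_sub _ _
      rw [abs_mul, abs_of_pos hu] at h3
      have : (C + |d|) * u ≤ (C + |d|) * V := by gcongr
      nlinarith [mul_pos hε hu]
  refine ⟨max 1 (8 * A / ε), fun T hT => ?_⟩
  have hT1 : 1 ≤ T := (le_max_left _ _).trans hT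
  have hT0 : 0 < T := by linarith
  have hTA : 8 * A / ε ≤ T := (le_max_right _ _).trans hT
  rw [div_le_iff₀ hε] at hTA
  have hlin : ∫ u in Ioc 0 T, d * u = d * (T ^ 2 / 2) := by
    rw [← intervalIntegral.integral_of_le hT0.le, intervalIntegral.integral_const_mul, integral_id]
    ring
  have hlini : IntegrableOn (fun u => d * u) (Ioc 0 T) :=
    ((continuous_const.mul continuous_id).integrableOn_Icc (a := 0) (b := T)).mono_set
      Ioc_subset_Icc_self
  have hb : |∫ u in Ioc 0 T, (G u - d * u)| ≤ (ε / 4 * T + A) * T :=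
    abs_setIntegral_Ioc_le hT0.le fun u hu => (key u hu.1).trans (by gcongr; exact hu.2)
  rw [integral_sub (hGi T) hlini, hlin] at hb
  rw [setIntegral_sub_mul_eq hg hC, Real.dist_eq]
  have : 2 / T ^ 2 * (∫ u in Ioc 0 T, G u) - d
      = 2 / T ^ 2 * ((∫ u in Ioc 0 T, G u) - d * (T ^ 2 / 2)) := by field_simp
  rw [this, abs_mul, abs_of_pos (by positivity)]
  calc _ ≤ 2 / T ^ 2 * ((ε / 4 * T + A) * T) := by gcongr
    _ = ε / 2 + 2 * A / T := by field_simp; ring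
    _ < ε := by
      have : 2 * A / T ≤ ε / 4 := by rw [div_le_iff₀ hT0]; linarith
      linarith

namespace MarkovSemigroup

variable {X : Type*} [MeasurableSpace X] (M : MarkovSemigroup X)

theorem measurable_P (t : ℝ) : Measurable (M.P t) :=
  M.meas.comp measurable_prodMk_left

theorem isProbabilityMeasure_dual (t : ℝ) (μ : Measure X) [IsProbabilityMeasure μ] :
    IsProbabilityMeasure (M.dual t μ) := by
  refine ⟨?_⟩
  have := M.prob t
  rw [dual, Measure.bind_apply MeasurableSet.univ (M.measurable_P t).aemeasurable]
  simp

theorem measurable_dual (μ : Measure X) [IsProbabilityMeasure μ] :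
    Measurable fun t => M.dual t μ := by
  refine Measure.measurable_of_measurable_coe _ fun S hS => ?_
  simp only [dual, Measure.bind_apply hS (M.measurable_P _).aemeasurable]
  exact ((Measure.measurable_coe hS).comp M.meas).lintegral_prod_right'

theorem integral_dual (t : ℝ) (μ : Measure X) [IsProbabilityMeasure μ] {f : X → ℝ}
    (hf : Measurable f) {C : ℝ} (hC : ∀ y, |f y| ≤ C) :
    ∫ y, f y ∂(M.dual t μ) = ∫ x, M.act t f x ∂μ :=
  integral_bind_of_bounded μ (M.measurable_P t) (M.prob t) hf hC

theorem integral_QM {T : ℝ} (hT : 0 < T) (μ : Measure X) [IsProbabilityMeasure μ] {f : X → ℝ}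
    (hf : Measurable f) {C : ℝ} (hC : ∀ y, |f y| ≤ C) :
    ∫ y, f y ∂(M.QM T μ) = (1 / T) * ∫ s in Ioc 0 T, ∫ y, f y ∂(M.dual s μ) := by
  rw [QM, if_neg hT.not_ge]
  have : IsFiniteMeasure ((ENNReal.ofReal (1 / T)) • (volume.restrict (Ioc (0 : ℝ) T))) :=
    Measure.smul_finite _ ENNReal.ofReal_ne_top
  rw [integral_bind_of_bounded _ (M.measurable_dual μ)
    (fun s => M.isProbabilityMeasure_dual s μ) hf hC, integral_smul_measure,
    ENNReal.toReal_ofReal (by positivity), smul_eq_mul]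

theorem measurable_integral_dual (μ : Measure X) [IsProbabilityMeasure μ] {f : ℝ × X → ℝ}
    (hf : Measurable f) : Measurable fun s => ∫ y, f (s, y) ∂(M.dual s μ) := by
  let k : ProbabilityTheory.Kernel ℝ X := ⟨fun s => M.dual s μ, M.measurable_dual μ⟩
  have : ProbabilityTheory.IsMarkovKernel k := ⟨fun s => M.isProbabilityMeasure_dual s μ⟩
  exact (hf.stronglyMeasurable.integral_kernel_prod_right' (κ := k)).measurable

theorem measurable_act {f : X → ℝ} (hf : Measurable f) :
    Measurable fun p : ℝ × X => M.act p.1 f p.2 := by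
  let k : ProbabilityTheory.Kernel (ℝ × X) X := ⟨fun p => M.P p.1 p.2, M.meas⟩
  have : ProbabilityTheory.IsMarkovKernel k := ⟨fun p => M.prob _ _⟩
  exact (hf.stronglyMeasurable.integral_kernel (κ := k)).measurable

theorem abs_act_le {f : X → ℝ} {C : ℝ} (hC : ∀ y, |f y| ≤ C) (t : ℝ) (x : X) :
    |M.act t f x| ≤ C :=
  have := M.prob t x
  abs_integral_le_of_abs_le _ hC

theorem integrableOn_act {f : X → ℝ} (hf : Measurable f) {C : ℝ} (hC : ∀ y, |f y| ≤ C)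
    (a b : ℝ) (x : X) : IntegrableOn (fun s => M.act s f x) (Ioc a b) :=
  integrableOn_Ioc_of_bounded ((M.measurable_act hf).comp measurable_prodMk_right) _ _
    fun s _ => M.abs_act_le hC s x

theorem measurable_Psi {f : X → ℝ} (hf : Measurable f) :
    Measurable fun p : ℝ × X => M.Psi f p.1 p.2 := by
  refine Measurable.ite (measurableSet_le measurable_fst measurable_const)
    (hf.comp measurable_snd) ((measurable_const.div measurable_fst).mul ?_)
  have h : Measurable fun q : (ℝ × X) × ℝ =>
      {q : (ℝ × X) × ℝ | 0 < q.2 ∧ q.2 ≤ q.1.1}.indicator (fun q => M.act q.2 f q.1.2) q := by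
    refine ((M.measurable_act hf).comp
      (measurable_snd.prodMk measurable_fst.snd)).indicator ?_
    exact (measurableSet_lt measurable_const measurable_snd).inter
      (measurableSet_le measurable_snd measurable_fst.fst)
  convert h.stronglyMeasurable.integral_prod_right' (ν := volume) |>.measurable using 2 with p
  rw [← integral_indicator measurableSet_Ioc]
  rfl

theorem Psi_of_pos {f : X → ℝ} {t : ℝ} (ht : 0 < t) (x : X) :
    M.Psi f t x = (1 / t) * ∫ s in Ioc 0 t, M.act s f x :=
  if_neg ht.not_ge

theorem abs_Psi_le {f : X → ℝ} {C : ℝ} (hC : ∀ y, |f y| ≤ C) (t : ℝ) (x : X) :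
    |M.Psi f t x| ≤ C := by
  rcases le_or_gt t 0 with ht | ht
  · rw [Psi, if_pos ht]; exact hC x
  · rw [M.Psi_of_pos ht, abs_mul, abs_of_pos (by positivity)]
    have := abs_setIntegral_Ioc_le ht.le fun s _ => M.abs_act_le hC s x
    calc _ ≤ 1 / t * (C * t) := by gcongr
      _ = C := by field_simp

theorem abs_Psi_sub_le {f : X → ℝ} (hf : Measurable f) {C : ℝ} (hC : ∀ y, |f y| ≤ C)
    {x z : X} {ε : ℝ} (h : ∀ t, 0 ≤ t → |M.act t f z - M.act t f x| ≤ ε) {t : ℝ} (ht : 0 < t) :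
    |M.Psi f t z - M.Psi f t x| ≤ ε := by
  rw [M.Psi_of_pos ht, M.Psi_of_pos ht, ← mul_sub,
    ← integral_sub (M.integrableOn_act hf hC _ _ z) (M.integrableOn_act hf hC _ _ x), abs_mul,
    abs_of_pos (by positivity)]
  have := abs_setIntegral_Ioc_le ht.le fun s hs => h s hs.1.le
  calc _ ≤ 1 / t * (ε * t) := by gcongr
    _ = ε := by field_simp

theorem act_eq_integral_dual_dirac (t : ℝ) (f : X → ℝ) (x : X) :
    M.act t f x = ∫ y, f y ∂(M.dual t (Measure.dirac x)) := by
  rw [dual, Measure.dirac_bind (M.measurable_P t), act]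

/-- The worst deviation from `d` of the time averages over windows of length at least `N`. -/
def tailDeviation (f : X → ℝ) (d N : ℝ) (x : X) : ℝ :=
  ⨆ t : Ici N, |M.Psi f t x - d|

theorem abs_Psi_sub_const_le {f : X → ℝ} {C : ℝ} (hC : ∀ y, |f y| ≤ C) {d : ℝ} (hd : |d| ≤ C)
    (t : ℝ) (x : X) : |M.Psi f t x - d| ≤ 2 * C := by
  have h1 := abs_sub (M.Psi f t x) d
  have h2 := M.abs_Psi_le hC t x
  linarith

theorem le_tailDeviation {f : X → ℝ} {C : ℝ} (hC : ∀ y, |f y| ≤ C) {d : ℝ} (hd : |d| ≤ C)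
    {N t : ℝ} (ht : N ≤ t) (x : X) : |M.Psi f t x - d| ≤ M.tailDeviation f d N x :=
  le_ciSup (f := fun t : Ici N => |M.Psi f t x - d|)
    ⟨2 * C, by rintro _ ⟨t, rfl⟩; exact M.abs_Psi_sub_const_le hC hd t x⟩ ⟨t, ht⟩

theorem tailDeviation_le {f : X → ℝ} {d N : ℝ} {x : X} {c : ℝ}
    (h : ∀ t, N ≤ t → |M.Psi f t x - d| ≤ c) : M.tailDeviation f d N x ≤ c :=
  ciSup_le fun t => h t t.2

theorem tailDeviation_nonneg (f : X → ℝ) (d N : ℝ) (x : X) : 0 ≤ M.tailDeviation f d N x :=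
  Real.iSup_nonneg fun _ => abs_nonneg _

theorem abs_tailDeviation_le {f : X → ℝ} {C : ℝ} (hC : ∀ y, |f y| ≤ C) {d : ℝ} (hd : |d| ≤ C)
    (N : ℝ) (x : X) : |M.tailDeviation f d N x| ≤ 2 * C := by
  rw [abs_of_nonneg (M.tailDeviation_nonneg f d N x)]
  exact M.tailDeviation_le fun t _ => M.abs_Psi_sub_const_le hC hd t x

theorem tendsto_tailDeviation {f : X → ℝ} {d : ℝ} {x : X}
    (h : Tendsto (fun t => M.Psi f t x) atTop (𝓝 d)) :
    Tendsto (fun N => M.tailDeviation f d N x) atTop (𝓝 0) := by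
  rw [Metric.tendsto_atTop] at h ⊢
  intro ε hε
  obtain ⟨U, hU⟩ := h (ε / 2) (half_pos hε)
  refine ⟨U, fun N hN => ?_⟩
  rw [Real.dist_0_eq_abs, abs_of_nonneg (M.tailDeviation_nonneg f d N x)]
  have : M.tailDeviation f d N x ≤ ε / 2 := M.tailDeviation_le fun t ht => by
    rw [← Real.dist_eq]; exact (hU t (hN.trans ht)).le
  linarith

end MarkovSemigroup

theorem IsBddLipschitz.isBddContinuous {X : Type*} [MeasurableSpace X] [PseudoMetricSpace X]
    {f : X → ℝ} (hf : IsBddLipschitz f) : MarkovSemigroup.IsBddContinuous f :=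
  ⟨hf.1.choose_spec.continuous, hf.2⟩

namespace MarkovSemigroup

variable {X : Type*} [MeasurableSpace X] [PseudoMetricSpace X] [OpensMeasurableSpace X]
  (M : MarkovSemigroup X)

theorem EProperty.continuous_tailDeviation (hE : M.EProperty) {f : X → ℝ} (hf : IsBddLipschitz f)
    {C : ℝ} (hC : ∀ y, |f y| ≤ C) {d : ℝ} (hd : |d| ≤ C) {N : ℝ} (hN : 0 < N) :
    Continuous (M.tailDeviation f d N) := by
  have hfm : Measurable f := hf.isBddContinuous.1.measurable
  rw [Metric.continuous_iff]
  intro x ε hε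
  obtain ⟨δ, hδ, h⟩ := hE f hf x (ε / 2) (half_pos hε)
  refine ⟨δ, hδ, fun z hz => ?_⟩
  have key : ∀ t, N ≤ t → |M.Psi f t z - M.Psi f t x| ≤ ε / 2 := fun t ht =>
    M.abs_Psi_sub_le hfm hC (fun s hs => (h z hz s hs).le) (hN.trans_le ht)
  have h1 : M.tailDeviation f d N z ≤ M.tailDeviation f d N x + ε / 2 :=
    M.tailDeviation_le fun t ht => by
      have := abs_sub_le (M.Psi f t z) (M.Psi f t x) d
      have := key t ht
      have := M.le_tailDeviation hC hd ht x
      linarith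
  have h2 : M.tailDeviation f d N x ≤ M.tailDeviation f d N z + ε / 2 :=
    M.tailDeviation_le fun t ht => by
      have := abs_sub_le (M.Psi f t x) (M.Psi f t z) d
      have := key t ht
      rw [abs_sub_comm] at this
      have := M.le_tailDeviation hC hd ht z
      linarith
  rw [Real.dist_eq, abs_lt]
  constructor <;> linarith

theorem QTendsto.tendsto_average {M : MarkovSemigroup X} {μ ν : Measure X}
    [IsProbabilityMeasure μ] (h : M.QTendsto μ ν) {f : X → ℝ} (hf : IsBddContinuous f) :
    Tendsto (fun T : ℝ => (1 / T) * ∫ s in Ioc 0 T, ∫ y, f y ∂(M.dual s μ)) atTop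
      (𝓝 (∫ y, f y ∂ν)) := by
  obtain ⟨C, hC⟩ := hf.2
  refine (h f hf).congr' ?_
  filter_upwards [eventually_gt_atTop 0] with T hT
  exact M.integral_QM hT μ hf.1.measurable hC

theorem WeakStarMeanErgodic.tendsto_Psi {M : MarkovSemigroup X} {ν : Measure X}
    (h : M.WeakStarMeanErgodic ν) {f : X → ℝ} (hf : IsBddContinuous f) (x : X) :
    Tendsto (fun t => M.Psi f t x) atTop (𝓝 (∫ y, f y ∂ν)) := by
  refine ((h (Measure.dirac x) inferInstance).tendsto_average hf).congr' ?_
  filter_upwards [eventually_gt_atTop 0] with t ht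
  simp only [M.Psi_of_pos ht, M.act_eq_integral_dual_dirac]

theorem WeakStarMeanErgodic.tendsto_integral_tailDeviation {M : MarkovSemigroup X}
    {ν : Measure X} [IsProbabilityMeasure ν] (h : M.WeakStarMeanErgodic ν) (hE : M.EProperty)
    {f : X → ℝ} (hf : IsBddLipschitz f) {C : ℝ} (hC : ∀ y, |f y| ≤ C) :
    Tendsto (fun N => ∫ x, M.tailDeviation f (∫ y, f y ∂ν) N x ∂ν) atTop (𝓝 0) := by
  have hd : |∫ y, f y ∂ν| ≤ C := abs_integral_le_of_abs_le ν hC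
  have := tendsto_integral_filter_of_dominated_convergence (μ := ν) (l := atTop)
    (F := fun N x => M.tailDeviation f (∫ y, f y ∂ν) N x) (f := fun _ => 0) (fun _ => 2 * C)
    ?_ (.of_forall fun N => .of_forall fun x => M.abs_tailDeviation_le hC hd N x)
    (integrable_const _)
    (.of_forall fun x => M.tendsto_tailDeviation (h.tendsto_Psi hf.isBddContinuous x))
  · simpa using this
  · filter_upwards [eventually_gt_atTop 0] with N hN
    exact (hE.continuous_tailDeviation M hf hC hd hN).measurable.aestronglyMeasurable

end MarkovSemigroup

namespace MarkovSemigroup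

variable {X : Type*} [MeasurableSpace X] (M : MarkovSemigroup X)

theorem abs_integral_mul_Psi_sub_le {f : X → ℝ} (hf : Measurable f) {C : ℝ}
    (hC : ∀ y, |f y| ≤ C) {d : ℝ} (hd : |d| ≤ C) {N : ℝ}
    (hF : Measurable (M.tailDeviation f d N)) (ν : Measure X) [IsProbabilityMeasure ν]
    (t : ℝ) :
    |(∫ y, f y * M.Psi f t y ∂ν) - d * ∫ y, f y ∂ν| ≤
      C * (∫ y, M.tailDeviation f d N y ∂ν) + (Iio N).indicator (fun _ => 2 * C ^ 2) t := by
  have hC0 : 0 ≤ C := (abs_nonneg _).trans hd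
  have hPm : Measurable (M.Psi f t) := (M.measurable_Psi hf).comp measurable_prodMk_left
  have hprod : Integrable (fun y => f y * M.Psi f t y) ν :=
    .of_bound (hf.mul hPm).aestronglyMeasurable (C * C) (.of_forall fun y => by
      rw [Real.norm_eq_abs, abs_mul]
      exact mul_le_mul (hC y) (M.abs_Psi_le hC t y) (abs_nonneg _) hC0)
  have hfi : Integrable f ν := .of_bound hf.aestronglyMeasurable C (.of_forall hC)
  have hFi : Integrable (M.tailDeviation f d N) ν :=
    .of_bound hF.aestronglyMeasurable _ (.of_forall (M.abs_tailDeviation_le hC hd N))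
  have hF0 : 0 ≤ ∫ y, M.tailDeviation f d N y ∂ν :=
    integral_nonneg (M.tailDeviation_nonneg f d N)
  rw [← integral_const_mul, ← integral_sub hprod (hfi.const_mul d)]
  have hpt : ∀ y, |f y * M.Psi f t y - d * f y| ≤ C * |M.Psi f t y - d| := fun y => by
    rw [mul_comm d, ← mul_sub, abs_mul]
    gcongr
    exact hC y
  rcases lt_or_ge t N with ht | ht
  · rw [indicator_of_mem (mem_Iio.2 ht)]
    have : |∫ y, (f y * M.Psi f t y - d * f y) ∂ν| ≤ 2 * C ^ 2 :=
      abs_integral_le_of_abs_le ν fun y => (hpt y).trans <| by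
        have := mul_le_mul_of_nonneg_left (M.abs_Psi_sub_const_le hC hd t y) hC0
        linarith
    have := mul_nonneg hC0 hF0
    linarith
  · rw [indicator_of_notMem (by simpa using ht), add_zero, ← integral_const_mul]
    refine norm_integral_le_of_norm_le (f := fun y => f y * M.Psi f t y - d * f y)
      (hFi.const_mul C) (.of_forall fun y => (hpt y).trans ?_)
    exact mul_le_mul_of_nonneg_left (M.le_tailDeviation hC hd ht y) hC0

theorem abs_second_moment_sub_le {f : X → ℝ} (hf : Measurable f) {C : ℝ}
    (hC : ∀ y, |f y| ≤ C) {d : ℝ} (hd : |d| ≤ C) {N : ℝ} (hN : 0 ≤ N)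
    (hF : Measurable (M.tailDeviation f d N)) (μ : Measure X) [IsProbabilityMeasure μ]
    {T : ℝ} (hT : 0 < T) :
    |(2 / T ^ 2) * (∫ s in Ioc 0 T, (T - s) * ∫ y, f y * M.Psi f (T - s) y ∂(M.dual s μ)) -
        d * ((2 / T ^ 2) * ∫ s in Ioc 0 T, (T - s) * ∫ y, f y ∂(M.dual s μ))| ≤
      2 * C * ((1 / T) * ∫ s in Ioc 0 T, ∫ y, M.tailDeviation f d N y ∂(M.dual s μ)) +
        4 * C ^ 2 * N / T := by
  have hprob := fun s => M.isProbabilityMeasure_dual s μ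
  have hC0 : 0 ≤ C := (abs_nonneg _).trans hd
  have hfP : Measurable fun p : ℝ × X => f p.2 * M.Psi f (T - p.1) p.2 :=
    (hf.comp measurable_snd).mul ((M.measurable_Psi hf).comp
      ((measurable_const.sub measurable_fst).prodMk measurable_snd))
  have hTs : ∀ s ∈ Ioc 0 T, |T - s| ≤ T := fun s hs => by
    rw [abs_of_nonneg (sub_nonneg.2 hs.2)]; linarith [hs.1]
  have hi1 : IntegrableOn (fun s => (T - s) * ∫ y, f y * M.Psi f (T - s) y ∂(M.dual s μ))
      (Ioc 0 T) := by
    refine integrableOn_Ioc_of_bounded ((measurable_const.sub measurable_id).mul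
      (M.measurable_integral_dual μ hfP)) (C := T * (C * C)) _ _ fun s hs => ?_
    rw [Pi.mul_apply, abs_mul]
    refine mul_le_mul (hTs s hs) (abs_integral_le_of_abs_le _ fun y => ?_) (abs_nonneg _) hT.le
    rw [abs_mul]
    exact mul_le_mul (hC y) (M.abs_Psi_le hC _ y) (abs_nonneg _) hC0
  have hi2 : IntegrableOn (fun s => (T - s) * ∫ y, f y ∂(M.dual s μ)) (Ioc 0 T) := by
    refine integrableOn_Ioc_of_bounded ((measurable_const.sub measurable_id).mul
      (M.measurable_integral_dual μ (hf.comp measurable_snd))) (C := T * C) _ _ fun s hs => ?_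
    rw [Pi.mul_apply, abs_mul]
    exact mul_le_mul (hTs s hs) (abs_integral_le_of_abs_le _ hC) (abs_nonneg _) hT.le
  have hi3 : IntegrableOn (fun s => ∫ y, M.tailDeviation f d N y ∂(M.dual s μ)) (Ioc 0 T) :=
    integrableOn_Ioc_of_bounded (M.measurable_integral_dual μ (hF.comp measurable_snd)) _ _
      fun s _ => abs_integral_le_of_abs_le _ (M.abs_tailDeviation_le hC hd N)
  have hi4 : IntegrableOn ((Ioi (T - N)).indicator fun _ => 2 * C ^ 2) (Ioc 0 T) :=
    (integrableOn_const measure_Ioc_lt_top.ne).indicator measurableSet_Ioi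
  have hbound : |∫ s in Ioc 0 T, ((T - s) * (∫ y, f y * M.Psi f (T - s) y ∂(M.dual s μ)) -
      d * ((T - s) * ∫ y, f y ∂(M.dual s μ)))| ≤
      ∫ s in Ioc 0 T, T * (C * (∫ y, M.tailDeviation f d N y ∂(M.dual s μ)) +
        (Ioi (T - N)).indicator (fun _ => 2 * C ^ 2) s) := by
    refine norm_integral_le_of_norm_le
      (f := fun s => (T - s) * (∫ y, f y * M.Psi f (T - s) y ∂(M.dual s μ)) -
        d * ((T - s) * ∫ y, f y ∂(M.dual s μ)))
      (g := fun s => T *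
      (C * (∫ y, M.tailDeviation f d N y ∂(M.dual s μ)) +
        (Ioi (T - N)).indicator (fun _ => 2 * C ^ 2) s))
      (((hi3.const_mul C).add hi4).const_mul T)
      ((ae_restrict_iff' measurableSet_Ioc).2 (.of_forall fun s hs => ?_))
    rw [mul_left_comm d, ← mul_sub, norm_mul]
    refine mul_le_mul (hTs s hs) ?_ (norm_nonneg _) hT.le
    refine (M.abs_integral_mul_Psi_sub_le hf hC hd hF (M.dual s μ) (T - s)).trans_eq ?_
    simp only [indicator, mem_Iio, mem_Ioi, sub_lt_comm]
  have hind : ∫ s in Ioc 0 T, (Ioi (T - N)).indicator (fun _ => 2 * C ^ 2) s ≤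
      2 * C ^ 2 * N := by
    rw [integral_indicator measurableSet_Ioi, Measure.restrict_restrict measurableSet_Ioi,
      setIntegral_const, smul_eq_mul, mul_comm]
    gcongr
    calc volume.real (Ioi (T - N) ∩ Ioc 0 T) ≤ volume.real (Ioc (T - N) T) :=
          measureReal_mono (fun s hs => ⟨hs.1, hs.2.2⟩) measure_Ioc_lt_top.ne
      _ = N := by simp [hN]
  rw [integral_sub hi1 (hi2.const_mul d), integral_const_mul, integral_const_mul,
    integral_add (hi3.const_mul C) hi4, integral_const_mul] at hbound
  rw [mul_left_comm d, ← mul_sub, abs_mul, abs_of_pos (by positivity)]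
  set A := ∫ s in Ioc 0 T, ∫ y, M.tailDeviation f d N y ∂(M.dual s μ)
  calc _ ≤ 2 / T ^ 2 * (T * (C * A + 2 * C ^ 2 * N)) := by
        refine mul_le_mul_of_nonneg_left (hbound.trans ?_) (by positivity)
        gcongr
    _ = _ := by field_simp; ring

end MarkovSemigroup

/-- weak law of large numbers, in semigroup terms. For a Feller,
stochastically continuous semigroup with the e-property which is weak-* mean ergodic
with limit `μ*`, both the first and the second moment of the time averages of a bounded
Lipschitz observable converge to the corresponding moments of `d* = ∫ ψ dμ*`. -/
theorem weak_law_of_large_numbers_semigroup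
    {X : Type*} [MetricSpace X] [CompleteSpace X] [SecondCountableTopology X]
    [MeasurableSpace X] [BorelSpace X]
    (M : MarkovSemigroup X)
    (hFeller : M.Feller) (hSC : M.StochasticallyContinuous) (hE : M.EProperty)
    (μstar : MeasureTheory.Measure X)
    (hμstar : MeasureTheory.IsProbabilityMeasure μstar)
    (hErg : M.WeakStarMeanErgodic μstar)
    (ψ : X → ℝ) (hψ : IsBddLipschitz ψ)
    (dstar : ℝ) (hdstar : dstar = ∫ y, ψ y ∂μstar) :
    ∀ μ : MeasureTheory.Measure X, MeasureTheory.IsProbabilityMeasure μ →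
      Filter.Tendsto
        (fun T : ℝ => (1 / T) * ∫ t in Set.Ioc (0 : ℝ) T, ∫ x, M.act t ψ x ∂μ)
        Filter.atTop (nhds dstar) ∧
      Filter.Tendsto
        (fun T : ℝ => (2 / T ^ 2) * ∫ s in Set.Ioc (0 : ℝ) T,
          ((T - s) * ∫ x, M.act s (fun y => ψ y * M.Psi ψ (T - s) y) x ∂μ))
        Filter.atTop (nhds (dstar ^ 2)) := by
  intro μ hμ
  have hψc := hψ.isBddContinuous
  have hψm : Measurable ψ := hψc.1.measurable
  obtain ⟨C, hC⟩ := hψ.2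
  subst hdstar
  set d := ∫ y, ψ y ∂μstar with hd_def
  have hd : |d| ≤ C := abs_integral_le_of_abs_le μstar hC
  have hC0 : 0 ≤ C := (abs_nonneg _).trans hd
  have havg := (hErg μ hμ).tendsto_average hψc
  refine ⟨?_, ?_⟩
  · simpa only [M.integral_dual _ μ hψm hC] using havg
  have hprob := fun s => M.isProbabilityMeasure_dual s μ
  have hmain := (tendsto_weighted_average
    (M.measurable_integral_dual μ (hψm.comp measurable_snd))
    (fun s => abs_integral_le_of_abs_le (M.dual s μ) hC) havg).const_mul d
  simp only [Function.comp_apply, ← hd_def, ← sq] at hmain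
  have hrw : ∀ T s : ℝ, ∫ x, M.act s (fun y => ψ y * M.Psi ψ (T - s) y) x ∂μ =
      ∫ y, ψ y * M.Psi ψ (T - s) y ∂(M.dual s μ) := fun T s =>
    (M.integral_dual s μ
      (hψm.mul ((M.measurable_Psi hψm).comp measurable_prodMk_left)) (C := C * C) fun y => by
        rw [Pi.mul_apply, abs_mul]
        exact mul_le_mul (hC y) (M.abs_Psi_le hC _ y) (abs_nonneg _) hC0).symm
  simp only [hrw]
  refine (tendsto_iff_of_dist ?_).2 hmain
  rw [Metric.tendsto_atTop]
  intro ε hε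
  obtain ⟨N, hNpos, hNε⟩ : ∃ N, 0 < N ∧
      2 * C * ∫ x, M.tailDeviation ψ d N x ∂μstar < ε := by
    have := (hErg.tendsto_integral_tailDeviation hE hψ hC).const_mul (2 * C)
    rw [mul_zero] at this
    exact ((eventually_gt_atTop 0).and (this.eventually_lt_const hε)).exists
  have hFc := hE.continuous_tailDeviation M hψ hC hd hNpos
  have hlim := (((hErg μ hμ).tendsto_average
    ⟨hFc, 2 * C, M.abs_tailDeviation_le hC hd N⟩).const_mul (2 * C)).add
    (tendsto_const_nhds (x := 4 * C ^ 2 * N).div_atTop tendsto_id)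
  rw [add_zero] at hlim
  obtain ⟨T₀, hT₀⟩ := eventually_atTop.1
    ((eventually_gt_atTop 0).and (hlim.eventually_lt_const hNε))
  refine ⟨T₀, fun T hT => ?_⟩
  obtain ⟨hTpos, hlt⟩ := hT₀ T hT
  rw [Real.dist_0_eq_abs, abs_of_nonneg dist_nonneg, Real.dist_eq]
  exact (M.abs_second_moment_sub_le hψm hC hd hNpos.le hFc.measurable μ hTpos).trans_lt hlt
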